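/- Suppose 0 ≤ d < m, or d = m < n. Then u_d(x,T) = (−1)^{dm} · V(A) · V(B) · Sres_d(f,g) · T^{m−d}(T−1)^d in K[x,T]. -/

import Mathlib

open Polynomial Finset

variable {K : Type*} [Field K]

/-- Sylvester's double sum `Sylv^{p,q}(A,B;x)`. -/
noncomputable def sylvSum {m n : ℕ} (A : Fin m → K) (B : Fin n → K) (p q : ℕ) :
    Polynomial K :=
  ∑ Sa ∈ Finset.powersetCard p (Finset.univ : Finset (Fin m)),
    ∑ Sb ∈ Finset.powersetCard q (Finset.univ : Finset (Fin n)),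
      (∏ i ∈ Sa, (X - C (A i))) * (∏ j ∈ Sb, (X - C (B j))) *
        C (((∏ i ∈ Sa, ∏ j ∈ Sb, (A i - B j)) *
            (∏ i ∈ Saᶜ, ∏ j ∈ Sbᶜ, (A i - B j))) /
           ((∏ i ∈ Sa, ∏ i' ∈ Saᶜ, (A i - A i')) *
            (∏ j ∈ Sb, ∏ j' ∈ Sbᶜ, (B j - B j'))))

/-- The matrix whose determinant defines the `k`-th subresultant of `f` (of degree `m`) and
`g` (of degree `n`), with a general last column given by `wf` on the `f`-rows
and `wg` on the `g`-rows. -/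
noncomputable def sresMatGen (m n k : ℕ) (f g : Polynomial K) (wf wg : ℕ → Polynomial K) :
    Matrix (Fin ((n - k) + (m - k))) (Fin ((n - k) + (m - k))) (Polynomial K) :=
  Matrix.of fun r c =>
    if (r : ℕ) < n - k then
      if (c : ℕ) = (n - k) + (m - k) - 1 then wf (r : ℕ)
      else if (c : ℕ) ≤ m + (r : ℕ) then C (f.coeff (m + (r : ℕ) - (c : ℕ))) else 0
    else
      if (c : ℕ) = (n - k) + (m - k) - 1 then wg ((r : ℕ) - (n - k))
      else if (c : ℕ) ≤ n + ((r : ℕ) - (n - k)) then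
        C (g.coeff (n + ((r : ℕ) - (n - k)) - (c : ℕ)))
      else 0

/-- The `k`-th subresultant `Sres_k(f,g)`. -/
noncomputable def sres (m n k : ℕ) (f g : Polynomial K) : Polynomial K :=
  (sresMatGen m n k f g (fun i => X ^ (n - k - 1 - i) * f)
    (fun i => X ^ (m - k - 1 - i) * g)).det

/-- The polynomial `F_k`: the last column is replaced by `(x^{n-k-1},…,x^0,0,…,0)ᵀ`. -/
noncomputable def sresF (m n k : ℕ) (f g : Polynomial K) : Polynomial K :=
  (sresMatGen m n k f g (fun i => X ^ (n - k - 1 - i)) (fun _ => 0)).det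

/-- The polynomial `G_k`: the last column is replaced by `(0,…,0,x^{m-k-1},…,x^0)ᵀ`. -/
noncomputable def sresG (m n k : ℕ) (f g : Polynomial K) : Polynomial K :=
  (sresMatGen m n k f g (fun _ => 0) (fun i => X ^ (m - k - 1 - i))).det

/-- The `k`-th scalar subresultant `Δ_k(f,g)`, with the convention `Δ_m(f,g) = 1`
when `m = n`. -/
noncomputable def sresDelta (m n k : ℕ) (f g : Polynomial K) : K :=
  if m = n ∧ k = m then 1 else (sres m n k f g).coeff k

/-- The Vandermonde determinant `V(Γ)` of a list `Γ`. -/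
def vand {u : ℕ} (Γ : Fin u → K) : K :=
  ∏ i : Fin u, ∏ j ∈ Finset.Ioi i, (Γ j - Γ i)

/-- The matrix `U_d(x,T)`, viewed over `(K[x])[T]`: the outer variable `X` is `T`, and
the inner variable is `x`.  Its first `m+n-d` rows are `[⟨1,B⟩_{d'} | ⟨T,A⟩_{d'}]` and its
last `d` rows are `[⟨x-t,B⟩_d | ⟨x-t,A⟩_d]`. -/
noncomputable def sylvU {m n : ℕ} (A : Fin m → K) (B : Fin n → K) (d : ℕ) :
    Matrix (Fin (m + n)) (Fin (m + n)) (Polynomial (Polynomial K)) :=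
  Matrix.of fun r c =>
    if (r : ℕ) < m + n - d then
      if h : (c : ℕ) < n then C (C (B ⟨c, h⟩ ^ (r : ℕ)))
      else X * C (C (A ⟨(c : ℕ) - n, by have := c.isLt; omega⟩ ^ (r : ℕ)))
    else
      if h : (c : ℕ) < n then
        C ((C (B ⟨c, h⟩)) ^ ((r : ℕ) - (m + n - d)) * (X - C (B ⟨c, h⟩)))
      else
        C ((C (A ⟨(c : ℕ) - n, by have := c.isLt; omega⟩)) ^ ((r : ℕ) - (m + n - d)) *
           (X - C (A ⟨(c : ℕ) - n, by have := c.isLt; omega⟩)))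

/-- The `(m+n+1)`-square matrix over `K[T]` whose first `m+n-d` rows are
`[⟨1,B⟩_{d'} | ⟨T,A⟩_{d'} | 0]` and whose last `d+1` rows are
`[⟨1,B⟩_{d+1} | ⟨1,A⟩_{d+1} | e]`, where the last column vector `e` has a single
entry `1` in (0-based) position `e₀` of the bottom block. -/
noncomputable def sylvM {m n : ℕ} (A : Fin m → K) (B : Fin n → K) (d e₀ : ℕ) :
    Matrix (Fin (m + n + 1)) (Fin (m + n + 1)) (Polynomial K) :=
  Matrix.of fun r c =>
    if (r : ℕ) < m + n - d then
      if h : (c : ℕ) < n then C (B ⟨c, h⟩ ^ (r : ℕ))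
      else if h2 : (c : ℕ) < n + m then X * C (A ⟨(c : ℕ) - n, by omega⟩ ^ (r : ℕ))
      else 0
    else
      if h : (c : ℕ) < n then C (B ⟨c, h⟩ ^ ((r : ℕ) - (m + n - d)))
      else if h2 : (c : ℕ) < n + m then
        C (A ⟨(c : ℕ) - n, by omega⟩ ^ ((r : ℕ) - (m + n - d)))
      else if (r : ℕ) - (m + n - d) = e₀ then 1 else 0

/-- The determinant of the leading `N × N` block of a doubly infinite array. -/
def natDet {R : Type*} [CommRing R] (N : ℕ) (G : ℕ → ℕ → R) : R :=
  (Matrix.of fun i j : Fin N => G i j).det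

section natDet

variable {R : Type*} [CommRing R]

theorem natDet_congr {N : ℕ} {G H : ℕ → ℕ → R} (h : ∀ i < N, ∀ j < N, G i j = H i j) :
    natDet N G = natDet N H := by
  unfold natDet
  congr 1
  ext i j
  exact h i i.isLt j j.isLt

theorem natDet_mul (N : ℕ) (G H : ℕ → ℕ → R) :
    natDet N G * natDet N H = natDet N (fun i j => ∑ k ∈ range N, G i k * H k j) := by
  unfold natDet
  rw [← Matrix.det_mul]
  congr 1
  ext i j
  simp [Matrix.mul_apply, Finset.sum_range]

theorem map_natDet {S : Type*} [CommRing S] (φ : R →+* S) (N : ℕ) (G : ℕ → ℕ → R) :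
    φ (natDet N G) = natDet N (fun i j => φ (G i j)) := by
  unfold natDet
  rw [RingHom.map_det]
  rfl

theorem natDet_lowerTriangular {N : ℕ} {G : ℕ → ℕ → R} (h : ∀ i j, i < j → j < N → G i j = 0) :
    natDet N G = ∏ i ∈ range N, G i i := by
  unfold natDet
  have hG : (Matrix.of fun i j : Fin N => G i j).IsLowerTriangular :=
    fun i j hij => h i j (OrderDual.toDual_lt_toDual.mp hij) j.isLt
  rw [Matrix.det_of_isLowerTriangular _ hG, Finset.prod_range]
  rfl

theorem natDet_transpose (N : ℕ) (G : ℕ → ℕ → R) :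
    natDet N G = natDet N (fun i j => G j i) := by
  unfold natDet
  rw [← Matrix.det_transpose]
  rfl

theorem natDet_blockLower {p q : ℕ} {G : ℕ → ℕ → R}
    (h : ∀ i j, i < p → j < q → G i (p + j) = 0) :
    natDet (p + q) G = natDet p G * natDet q (fun i j => G (p + i) (p + j)) := by
  unfold natDet
  rw [← Matrix.det_submatrix_equiv_self finSumFinEquiv,
    ← Matrix.det_fromBlocks_zero₁₂ _ (Matrix.of fun (i : Fin q) (j : Fin p) => G (p + i) j)]
  congr 1
  ext (i | i) (j | j)
  · rfl
  · exact h i j i.isLt j.isLt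
  · rfl
  · rfl

theorem natDet_blockUpper {p q : ℕ} {G : ℕ → ℕ → R}
    (h : ∀ i j, i < q → j < p → G (p + i) j = 0) :
    natDet (p + q) G = natDet p G * natDet q (fun i j => G (p + i) (p + j)) := by
  rw [natDet_transpose, natDet_blockLower (fun i j hi hj => h j i hj hi), natDet_transpose p,
    natDet_transpose q]

theorem natDet_mul_row (N : ℕ) (v : ℕ → R) (G : ℕ → ℕ → R) :
    natDet N (fun i j => v i * G i j) = (∏ i ∈ range N, v i) * natDet N G := by
  unfold natDet
  rw [Finset.prod_range]
  exact Matrix.det_mul_column (fun i : Fin N => v i) _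

theorem natDet_cycle_columns {N d : ℕ} (hd : d < N) (G : ℕ → ℕ → R) :
    natDet N (fun i j => G i (if j < d then j + 1 else if j = d then 0 else j)) =
      (-1) ^ d * natDet N G := by
  have h := Matrix.det_permute' (Fin.cycleRange (⟨d, hd⟩ : Fin N))
    (Matrix.of fun i j : Fin N => G i j)
  rw [Fin.sign_cycleRange] at h
  unfold natDet
  convert h using 1
  · congr 1
    ext i j
    simp only [Matrix.of_apply, Matrix.submatrix_apply, id]
    congr 1
    rcases lt_trichotomy (j : ℕ) d with hj | hj | hj
    · rw [Fin.coe_cycleRange_of_lt (by exact hj), if_pos hj]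
    · rw [Fin.coe_cycleRange_of_le (by exact hj.le), if_pos (Fin.ext hj)]
      simp [hj]
    · rw [Fin.cycleRange_of_gt (by exact hj)]
      simp [hj.not_gt, hj.ne']
  · simp

theorem val_finRotate_pow (N k : ℕ) (i : Fin (N + 1)) :
    (((finRotate (N + 1)) ^ k) i : ℕ) = (i + k) % (N + 1) := by
  induction k with
  | zero => simp [Nat.mod_eq_of_lt i.isLt]
  | succ k ih =>
    rw [pow_succ', Equiv.Perm.mul_apply, finRotate_apply, Fin.val_add, ih, Fin.val_one',
      ← Nat.add_mod, add_assoc]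

theorem natDet_swap_rows (p q : ℕ) (G H : ℕ → ℕ → R) :
    natDet (q + p) (fun i j => if i < q then H i j else G (i - q) j) =
      (-1) ^ (p * q) * natDet (q + p) (fun i j => if i < p then G i j else H (i - p) j) := by
  rcases Nat.eq_zero_or_pos (q + p) with h0 | h0
  · obtain ⟨rfl, rfl⟩ : q = 0 ∧ p = 0 := by omega
    simp
    rfl
  obtain ⟨N, hN⟩ : ∃ N, q + p = N + 1 := ⟨q + p - 1, by omega⟩
  have h := Matrix.det_permute ((finRotate (N + 1)) ^ p)
    (Matrix.of fun i j : Fin (N + 1) => if (i : ℕ) < p then G i j else H (i - p) j)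
  have hs : (-1 : ℤˣ) ^ (N * p) = (-1) ^ (p * q) := by
    rw [neg_one_pow_congr]
    have : N * p + p = p * q + p * p := by
      calc N * p + p = (N + 1) * p := by ring
        _ = _ := by rw [← hN]; ring
    have h2 : Even (N * p + p) ↔ Even (p * q + p * p) := by rw [this]
    simp only [Nat.even_add, Nat.even_mul] at h2 ⊢
    tauto
  rw [map_pow, sign_finRotate, Nat.add_sub_cancel, ← pow_mul, hs] at h
  unfold natDet
  rw [hN]
  convert h using 1
  · congr 1
    ext i j
    have := i.isLt
    simp only [Matrix.of_apply, Matrix.submatrix_apply, id, val_finRotate_pow]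
    by_cases hi : (i : ℕ) < q
    · have e : ((i : ℕ) + p) % (N + 1) = i + p := Nat.mod_eq_of_lt (by omega)
      rw [if_pos hi, e, if_neg (by omega), Nat.add_sub_cancel]
    · have e : ((i : ℕ) + p) % (N + 1) = i - q := by
        rw [show (i : ℕ) + p = (i - q) + (N + 1) by omega, Nat.add_mod_right]
        exact Nat.mod_eq_of_lt (by omega)
      rw [if_neg hi, e, if_pos (by omega)]
  · simp

end natDet

theorem sum_coeff_mul_pow {R : Type*} [CommRing R] {P : R[X]} {N : ℕ} (h : P.natDegree < N)
    (x : R) : ∑ k ∈ range N, P.coeff k * x ^ k = P.eval x :=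
  (eval_eq_sum_range' h x).symm

theorem sum_coeff_mul_delta {R : Type*} [CommRing R] {P : R[X]} {N c : ℕ} (h : c < N) :
    ∑ k ∈ range N, P.coeff k * (if k = c then 1 else 0) = P.coeff c := by
  simp [h]

/-- The polynomials `G, X * G, …, X ^ (b - 1) * G, F, X * F, …`. -/
noncomputable def shiftRow {R : Type*} [CommRing R] (b : ℕ) (F G : R[X]) (i : ℕ) : R[X] :=
  if i < b then X ^ i * G else X ^ (i - b) * F

section subresultant

variable {R : Type*} [CommRing R]

/-- The polynomials `x - X, …, (x - X) * X ^ (d - 1)` followed by those of `shiftRow`. -/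
noncomputable def extendedRow (d b : ℕ) (x : R) (F G : R[X]) (i : ℕ) : R[X] :=
  if i < d then (C x - X) * X ^ i else shiftRow b F G (i - d)

theorem natDegree_C_sub_X_mul_X_pow_le (x : R) (i : ℕ) :
    ((C x - X) * X ^ i).natDegree ≤ i + 1 := by
  refine natDegree_mul_le.trans ?_
  have h1 : (C x - X : R[X]).natDegree ≤ 1 :=
    (natDegree_sub_le _ _).trans (by simp [natDegree_X_le])
  have h2 := natDegree_X_pow_le (R := R) i
  omega

theorem natDegree_extendedRow_lt {d b a : ℕ} (hab : 0 < b + a) (x : R) {F G : R[X]}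
    (hF : F.natDegree = d + b) (hG : G.natDegree ≤ d + a) {i : ℕ} (hi : i < d + (b + a)) :
    (extendedRow d b x F G i).natDegree < d + (b + a) := by
  unfold extendedRow shiftRow
  split_ifs with h1 h2
  · have := natDegree_C_sub_X_mul_X_pow_le x i
    omega
  · have := natDegree_mul_le (p := (X : R[X]) ^ (i - d)) (q := G)
    have h3 := natDegree_X_pow_le (R := R) (i - d)
    omega
  · have := natDegree_mul_le (p := (X : R[X]) ^ (i - d - b)) (q := F)
    have h3 := natDegree_X_pow_le (R := R) (i - d - b)
    omega

/-- Evaluating at the roots of `F` turns the coefficient determinant of the extended rows into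
a determinant of values. -/
theorem natDet_extendedRow_coeff_mul_vandermonde {d b a : ℕ} (hab : 0 < b + a) (x : R)
    {F G : R[X]} (hF : F.Monic) (hFd : F.natDegree = d + b) (hG : G.natDegree ≤ d + a) (α : ℕ → R)
    (hα : ∀ i < d + b, F.eval (α i) = 0) :
    natDet (d + (b + a)) (fun i j => (extendedRow d b x F G i).coeff j) *
        natDet (d + b) (fun i j => α j ^ i) =
      natDet (d + b) (fun i j =>
        if i < d then (x - α j) * α j ^ i else α j ^ (i - d) * G.eval (α j)) := by
  have hV : natDet (d + b) (fun i j => α j ^ i) = natDet ((d + b) + a)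
      (fun k c => if c < d + b then α c ^ k else if k = c then 1 else 0) := by
    rw [natDet_blockLower (p := d + b), natDet_lowerTriangular (N := a)]
    · rw [Finset.prod_eq_one (fun i _ => by simp), mul_one]
      exact natDet_congr fun i _ j hj => by simp [hj]
    · intro i j hij _
      simp [hij.ne]
    · intro i j hi hj
      rw [if_neg (by omega), if_neg (by omega)]
  rw [hV, ← add_assoc, natDet_mul]
  have hE : natDet (d + b + a) (fun i c => ∑ k ∈ range (d + b + a),
      (extendedRow d b x F G i).coeff k *
        (if c < d + b then α c ^ k else if k = c then 1 else 0)) =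
      natDet (d + b + a) (fun i c => if c < d + b then (extendedRow d b x F G i).eval (α c)
        else (extendedRow d b x F G i).coeff c) := by
    refine natDet_congr fun i hi c hc => ?_
    split_ifs
    · exact sum_coeff_mul_pow
        (by simpa only [add_assoc] using natDegree_extendedRow_lt hab x hFd hG (by omega)) _
    · exact sum_coeff_mul_delta hc
  rw [hE, natDet_blockUpper, natDet_lowerTriangular (N := a)]
  · rw [Finset.prod_eq_one, mul_one]
    · refine natDet_congr fun i hi j hj => ?_
      rw [if_pos hj]
      unfold extendedRow shiftRow
      split_ifs
      · simp
      · simp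
      · omega
    · intro i _
      rw [if_neg (by omega), extendedRow, if_neg (by omega), shiftRow, if_neg (by omega),
        show d + b + i - d - b = i by omega, coeff_X_pow_mul', if_pos (by omega),
        show d + b + i - i = F.natDegree by omega]
      exact hF
  · intro i j hij hj
    rw [if_neg (by omega), extendedRow, if_neg (by omega), shiftRow, if_neg (by omega),
      show d + b + i - d - b = i by omega, coeff_X_pow_mul', if_pos (by omega)]
    exact coeff_eq_zero_of_natDegree_lt (by omega)
  · intro i j hi hj
    rw [if_pos hj, extendedRow, if_neg (by omega), shiftRow, if_neg (by omega)]
    simp [hα j hj]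

theorem natDet_extendedRow_coeff {d b a : ℕ} (hab : 0 < b + a) (x : R) {F G : R[X]}
    (hFd : F.natDegree = d + b) (hG : G.natDegree ≤ d + a) :
    natDet (d + (b + a)) (fun i j => (extendedRow d b x F G i).coeff j) =
      natDet (b + a) (fun i j =>
        if j = 0 then (shiftRow b F G i).eval x else (shiftRow b F G i).coeff (d + j)) := by
  have hE : natDet (d + (b + a))
      (fun k c => if c = 0 then x ^ k else if k = c then (1 : R) else 0) = 1 := by
    rw [natDet_lowerTriangular]
    · exact Finset.prod_eq_one fun i _ => by by_cases h : i = 0 <;> simp [h]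
    · intro i j hij _
      rw [if_neg (by omega), if_neg (by omega)]
  have hM : natDet (d + (b + a)) (fun i c => ∑ k ∈ range (d + (b + a)),
      (extendedRow d b x F G i).coeff k *
        (if c = 0 then x ^ k else if k = c then 1 else 0)) =
      natDet (d + (b + a)) (fun i c => if c = 0 then (extendedRow d b x F G i).eval x
        else (extendedRow d b x F G i).coeff c) := by
    refine natDet_congr fun i hi c hc => ?_
    split_ifs
    · exact sum_coeff_mul_pow (natDegree_extendedRow_lt hab x hFd hG hi) _
    · exact sum_coeff_mul_delta hc
  have hsq : ((-1 : R) ^ d) * (-1) ^ d = 1 := by rw [← mul_pow]; simp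
  have hcyc := natDet_cycle_columns (N := d + (b + a)) (d := d) (by omega)
    (fun i c => if c = 0 then (extendedRow d b x F G i).eval x
        else (extendedRow d b x F G i).coeff c)
  rw [natDet_blockLower, natDet_lowerTriangular (N := d)] at hcyc
  · rw [Finset.prod_congr rfl (g := fun _ => (-1 : R)), prod_const, card_range] at hcyc
    · rw [← mul_one (natDet (d + (b + a)) _), ← hE, natDet_mul, hM,
        ← one_mul (natDet (d + (b + a)) _), ← hsq, mul_assoc, ← hcyc, ← mul_assoc, hsq, one_mul]
      refine natDet_congr fun i hi j hj => ?_
      simp only [extendedRow, if_neg (show ¬ d + i < d by omega), Nat.add_sub_cancel_left,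
        if_neg (show ¬ d + j < d by omega)]
      by_cases hj0 : j = 0
      · simp [hj0]
      · simp [hj0]
    · intro i hi
      have hi' := mem_range.mp hi
      simp [extendedRow, hi', sub_mul, ← pow_succ', coeff_X_pow]
  · intro i j hij hj
    rw [if_pos hj, if_neg (by omega), extendedRow, if_pos (by omega)]
    exact coeff_eq_zero_of_natDegree_lt
      ((natDegree_C_sub_X_mul_X_pow_le x i).trans_lt (by omega))
  · intro i j hi hj
    by_cases hj0 : j = 0
    · simp [hj0, extendedRow, hi]
    · simp only [extendedRow, if_pos hi, if_neg (show ¬ d + j < d by omega),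
        if_neg (show ¬ d + j = d by omega), if_neg (show ¬ d + j = 0 by omega)]
      exact coeff_eq_zero_of_natDegree_lt
        ((natDegree_C_sub_X_mul_X_pow_le x i).trans_lt (by omega))

end subresultant

section mixed

variable {R : Type*} [CommRing R]

/-- Row reduction of Sylvester's matrix `[1 | T; x - t | x - t]`, where `γ` lists the `n` elements
of `B` followed by the `b + d` elements of `A`. -/
theorem natDet_mixed {n b d : ℕ} (hd : d < n) (T x : R) (γ : ℕ → R) {G : R[X]}
    (hG : G.Monic) (hGd : G.natDegree = n) (hγ : ∀ i < n, G.eval (γ i) = 0) :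
    natDet (n + (b + d)) (fun i c =>
        if i < n + b then (if c < n then 1 else T) * γ c ^ i
        else γ c ^ (i - (n + b)) * (x - γ c)) =
      natDet n (fun i j => γ j ^ i) * (T ^ b * (1 - T) ^ d *
        natDet (b + d) (fun i j =>
          if i < b then γ (n + j) ^ i * G.eval (γ (n + j))
          else (x - γ (n + j)) * γ (n + j) ^ (i - b))) := by
  let P : ℕ → R[X] := fun i =>
    if i < n then X ^ i else if i < n + b then X ^ (i - n) * G
    else (X - C x) * X ^ (i - (n + b))
  let L : ℕ → ℕ → R := fun i k =>
    if k < n + b then (P i).coeff k else if i = k then 1 else 0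
  have hP : ∀ i < n + (b + d), (P i).natDegree < n + b := by
    intro i hi
    simp only [P]
    split_ifs with h1 h2
    · have := natDegree_X_pow_le (R := R) i
      omega
    · have := natDegree_mul_le (p := (X : R[X]) ^ (i - n)) (q := G)
      have h3 := natDegree_X_pow_le (R := R) (i - n)
      omega
    · have := natDegree_mul_le (p := X - C x) (q := (X : R[X]) ^ (i - (n + b)))
      have h3 := natDegree_X_pow_le (R := R) (i - (n + b))
      have h4 := natDegree_X_sub_C_le x
      omega
  have hL : natDet (n + (b + d)) L = 1 := by
    rw [natDet_lowerTriangular]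
    · refine Finset.prod_eq_one fun i hi => ?_
      simp only [L, P]
      split_ifs with h1 h2
      · simp
      · rw [coeff_X_pow_mul', if_pos (by omega), show i - (i - n) = G.natDegree by omega]
        exact hG
      · rfl
    · intro i j hij hj
      simp only [L]
      split_ifs with h1 h2
      · simp only [P]
        split_ifs with h3 h4
        · simp [coeff_X_pow, hij.ne']
        · rw [coeff_X_pow_mul', if_pos (by omega)]
          exact coeff_eq_zero_of_natDegree_lt (by omega)
        · omega
      · omega
      · rfl
  have hprod : ∀ i < n + (b + d), ∀ c, ∑ k ∈ range (n + (b + d)), L i k *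
      (if k < n + b then (if c < n then 1 else T) * γ c ^ k
        else γ c ^ (k - (n + b)) * (x - γ c)) =
      (if c < n then 1 else T) * (P i).eval (γ c) +
        if i < n + b then 0 else γ c ^ (i - (n + b)) * (x - γ c) := by
    intro i hi c
    rw [← add_assoc, Finset.sum_range_add]
    congr 1
    · rw [← sum_coeff_mul_pow (hP i hi), Finset.mul_sum]
      refine Finset.sum_congr rfl fun k hk => ?_
      have hk' := mem_range.mp hk
      simp only [L, if_pos hk']
      ring
    · by_cases h1 : i < n + b
      · rw [if_pos h1]
        refine Finset.sum_eq_zero fun k hk => ?_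
        simp only [L]
        rw [if_neg (by omega), if_neg (by omega), zero_mul]
      · rw [if_neg h1, Finset.sum_eq_single (i - (n + b))]
        · simp only [L]
          rw [if_neg (by omega), if_pos (by omega), if_neg (by omega), one_mul,
            show n + b + (i - (n + b)) - (n + b) = i - (n + b) by omega]
        · intro k hk hne
          simp only [L]
          rw [if_neg (by omega), if_neg (by omega), zero_mul]
        · intro h
          exact absurd (mem_range.mpr (by omega)) h
  have hmul := natDet_mul (n + (b + d)) L (fun i c =>
        if i < n + b then (if c < n then 1 else T) * γ c ^ i
        else γ c ^ (i - (n + b)) * (x - γ c))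
  rw [hL, one_mul, natDet_congr (fun i hi c _ => hprod i hi c)] at hmul
  rw [hmul, natDet_blockUpper]
  · congr 1
    · refine natDet_congr fun i hi j hj => ?_
      rw [if_pos hj, if_pos (by omega)]
      simp [P, hi]
    · have hT : ∏ i ∈ range (b + d), (if i < b then T else 1 - T) = T ^ b * (1 - T) ^ d := by
        rw [Finset.prod_range_add, Finset.prod_congr rfl (g := fun _ => T)
          (fun i hi => if_pos (mem_range.mp hi))]
        simp
      rw [← hT, ← natDet_mul_row]
      refine natDet_congr fun i hi j hj => ?_
      simp only [P]
      rw [if_neg (by omega), if_neg (by omega)]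
      by_cases h : i < b
      · rw [if_pos (by omega), if_pos (by omega), if_pos h, if_pos h]
        simp
      · rw [if_neg (by omega), if_neg (by omega), if_neg h, if_neg h,
          show n + i - (n + b) = i - b by omega]
        simp
        ring
  · intro i j hi hj
    simp only [P]
    rw [if_pos hj, if_neg (by omega)]
    by_cases h : i < b
    · rw [if_pos (by omega), if_pos (by omega)]
      simp [hγ j hj]
    · rw [if_neg (by omega), if_neg (by omega)]
      simp
      ring

end mixed

theorem neg_one_pow_mul_add {R : Type*} [CommRing R] (d b : ℕ) :
    (-1 : R) ^ (d * (d + b)) = (-1) ^ d * (-1) ^ (d * b) := by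
  rw [mul_add, pow_add, pow_mul]
  rcases Nat.even_or_odd d with h | h <;> simp [h.neg_one_pow]

theorem natDet_pow_eq_vand {m : ℕ} (A : Fin m → K) (α : ℕ → K) (hα : ∀ i : Fin m, α i = A i) :
    natDet m (fun i j => α j ^ i) = vand A := by
  rw [natDet_transpose]
  refine Eq.trans ?_ (Matrix.det_vandermonde A)
  unfold natDet
  congr 1
  ext i j
  simp [hα, Matrix.vandermonde_apply]

theorem sres_eq_natDet {d b a : ℕ} (f g : K[X]) :
    sres (d + b) (d + a) d f g = natDet (b + a) (fun i j =>
      if j = 0 then (shiftRow b (f.map C) (g.map C) i).eval X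
      else (shiftRow b (f.map C) (g.map C) i).coeff (d + j)) := by
  have hs : b + a = (d + a - d) + (d + b - d) := by omega
  have ev : ∀ p : K[X], (p.map C).eval X = p := fun p => by rw [eval_map, eval₂_C_X]
  unfold sres natDet
  rw [← Matrix.det_submatrix_equiv_self (Fin.revPerm.trans (finCongr hs))]
  congr 1
  ext1 i j
  have hi := i.isLt
  have hj := j.isLt
  simp only [Matrix.submatrix_apply, Matrix.of_apply, sresMatGen, Equiv.trans_apply,
    Fin.revPerm_apply, finCongr_apply, Fin.val_cast, Fin.val_rev]
  have hcol : b + a - ((j : ℕ) + 1) = d + a - d + (d + b - d) - 1 ↔ (j : ℕ) = 0 := by omega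
  simp only [hcol]
  by_cases hib : (i : ℕ) < b
  · rw [if_neg (by omega), shiftRow, if_pos hib]
    by_cases hj0 : (j : ℕ) = 0
    · rw [if_pos hj0, if_pos hj0, eval_mul, ev, eval_pow, eval_X]
      congr 2
      omega
    · rw [if_neg hj0, if_neg hj0, coeff_X_pow_mul', coeff_map]
      refine if_congr (by omega) ?_ rfl
      congr 2
      omega
  · rw [if_pos (by omega), shiftRow, if_neg hib]
    by_cases hj0 : (j : ℕ) = 0
    · rw [if_pos hj0, if_pos hj0, eval_mul, ev, eval_pow, eval_X]
      congr 2
      omega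
    · rw [if_neg hj0, if_neg hj0, coeff_X_pow_mul', coeff_map]
      refine if_congr (by omega) ?_ rfl
      congr 2
      omega

theorem sres_mul_vand {d b a : ℕ} (hab : 0 < b + a) {f g : K[X]} (hf : f.Monic)
    (hfd : f.natDegree = d + b) (hg : g.natDegree ≤ d + a) (A : Fin (d + b) → K) (α : ℕ → K)
    (hα : ∀ i : Fin (d + b), α i = A i) (hfα : ∀ i < d + b, f.eval (α i) = 0) :
    sres (d + b) (d + a) d f g * C (vand A) = natDet (d + b) (fun i j =>
      if i < d then (X - C (α j)) * C (α j) ^ i else C (α j) ^ (i - d) * C (g.eval (α j))) := by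
  have hev : ∀ (p : K[X]) (y : K), (p.map C).eval (C y) = C (p.eval y) := fun p y => by
    rw [eval_map, eval₂_at_apply]
  have hfd' : (f.map C).natDegree = d + b := by rw [hf.natDegree_map, hfd]
  have hg' : (g.map C).natDegree ≤ d + a := natDegree_map_le.trans hg
  rw [sres_eq_natDet, ← natDet_extendedRow_coeff hab X hfd' hg', ← natDet_pow_eq_vand A α hα,
    map_natDet]
  simp only [map_pow]
  rw [natDet_extendedRow_coeff_mul_vandermonde hab X (hf.map C) hfd' hg' (fun i => C (α i))
    (fun i hi => by rw [hev, hfα i hi, C_0])]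
  simp only [hev]

theorem det_sylvU_eq_natDet {d b a : ℕ} (A : Fin (d + b) → K) (B : Fin (d + a) → K)
    (γ : ℕ → K) (hB : ∀ j : Fin (d + a), γ j = B j) (hA : ∀ j : Fin (d + b), γ (d + a + j) = A j) :
    (sylvU A B d).det = natDet ((d + a) + (b + d)) (fun i c =>
      if i < d + a + b then (if c < d + a then 1 else X) * C (C (γ c)) ^ i
      else C (C (γ c)) ^ (i - (d + a + b)) * (C X - C (C (γ c)))) := by
  have hs : (d + a) + (b + d) = d + b + (d + a) := by omega
  unfold natDet
  rw [← Matrix.det_submatrix_equiv_self (finCongr hs)]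
  congr 1
  ext1 i c
  have hc := c.isLt
  simp only [Matrix.submatrix_apply, Matrix.of_apply, sylvU, finCongr_apply, Fin.val_cast]
  rw [show d + b + (d + a) - d = d + a + b by omega]
  by_cases hcn : (c : ℕ) < d + a
  · simp only [dif_pos hcn, if_pos hcn, ← hB]
    simp
  · have hγ : A ⟨(c : ℕ) - (d + a), by omega⟩ = γ c := by
      rw [← hA]
      congr 1
      simp only
      omega
    simp only [dif_neg hcn, if_neg hcn, hγ]
    simp

/-- **Theorem 7, case `0 ≤ d < m` or `d = m < n`**:
`u_d(x,T) = (-1)^{dm}·V(A)·V(B)·Sres_d(f,g)·T^{m-d}(T-1)^d` in `K[x,T]`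
(realized as `(K[x])[T]`, with outer variable `T`). -/
theorem det_sylvU_low {m n : ℕ} (hm : 1 ≤ m) (hn : 1 ≤ n) (hmn : m ≤ n)
    (A : Fin m → K) (B : Fin n → K) (hA : Function.Injective A) (hB : Function.Injective B)
    (f g : Polynomial K) (hf : f = ∏ i, (X - C (A i))) (hg : g = ∏ j, (X - C (B j)))
    (d : ℕ) (hd : d < m ∨ (d = m ∧ m < n)) :
    (sylvU A B d).det =
      (-1 : Polynomial (Polynomial K)) ^ (d * m) * C (C (vand A * vand B)) *
        C (sres m n d f g) * X ^ (m - d) * (X - 1) ^ d := by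
  obtain ⟨b, rfl⟩ : ∃ b, m = d + b := ⟨m - d, by omega⟩
  obtain ⟨a, rfl⟩ : ∃ a, n = d + a := ⟨n - d, by omega⟩
  have hab : 0 < b + a := by omega
  let γ : ℕ → K := fun j => if h : j < d + a then B ⟨j, h⟩
    else if h' : j - (d + a) < d + b then A ⟨j - (d + a), h'⟩ else 0
  have hγB : ∀ j : Fin (d + a), γ j = B j := fun j => by simp [γ]
  have hγA : ∀ j : Fin (d + b), γ (d + a + j) = A j := fun j => by simp [γ]
  have hfm : f.Monic := hf ▸ monic_prod_of_monic _ _ fun i _ => monic_X_sub_C _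
  have hgm : g.Monic := hg ▸ monic_prod_of_monic _ _ fun i _ => monic_X_sub_C _
  have hfd : f.natDegree = d + b := by simp [hf]
  have hgd : g.natDegree = d + a := by simp [hg]
  have hfA : ∀ i < d + b, f.eval (γ (d + a + i)) = 0 := fun i hi => by
    rw [show γ (d + a + i) = A ⟨i, hi⟩ from hγA ⟨i, hi⟩, hf, eval_prod]
    exact Finset.prod_eq_zero (mem_univ ⟨i, hi⟩) (by simp)
  have hgB : ∀ i < d + a, g.eval (γ i) = 0 := fun i hi => by
    rw [show γ i = B ⟨i, hi⟩ from hγB ⟨i, hi⟩, hg, eval_prod]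
    exact Finset.prod_eq_zero (mem_univ ⟨i, hi⟩) (by simp)
  let φ : K →+* K[X][X] := C.comp C
  have hev : ∀ y : K, (g.map φ).eval (C (C y)) = C (C (g.eval y)) := fun y => by
    rw [eval_map, show C (C y) = φ y from rfl, eval₂_at_apply]
    rfl
  have hS := congrArg (C : K[X] →+* K[X][X]) (sres_mul_vand hab hfm hfd hgd.le A
    (fun i => γ (d + a + i)) hγA hfA)
  have hV := congrArg φ (natDet_pow_eq_vand B γ hγB)
  rw [map_natDet] at hS hV
  have hsw := natDet_swap_rows d b
    (fun i j => (C X - C (C (γ (d + a + j)))) * C (C (γ (d + a + j))) ^ i)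
    (fun i j => C (C (γ (d + a + j))) ^ i * C (C (g.eval (γ (d + a + j)))))
  have hS' : natDet (b + d) (fun i j =>
      if i < d then (C X - C (C (γ (d + a + j)))) * C (C (γ (d + a + j))) ^ i
      else C (C (γ (d + a + j))) ^ (i - d) * C (C (g.eval (γ (d + a + j))))) =
      C (sres (d + b) (d + a) d f g * C (vand A)) := by
    rw [hS, add_comm b d]
    refine natDet_congr fun i _ j _ => ?_
    split_ifs <;> simp
  have hV' : natDet (d + a) (fun i j => C (C (γ j)) ^ i) = C (C (vand B)) := by
    refine Eq.trans (natDet_congr fun i _ j _ => ?_) hV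
    simp [φ]
  rw [det_sylvU_eq_natDet A B γ hγB hγA, natDet_mixed (by omega) X (C X) (fun j => C (C (γ j)))
    (hgm.map φ) (by rw [hgm.natDegree_map, hgd]) (fun i hi => by rw [hev, hgB i hi]; simp)]
  simp only [hev]
  rw [hsw, hS', hV', Nat.add_sub_cancel_left, show (1 - X : K[X][X]) = -1 * (X - 1) by ring,
    mul_pow]
  rw [neg_one_pow_mul_add]
  simp only [C_mul]
  ring
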